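/- Let λ, μ > 0 and let f be a probability density on ℝᴺ with finite second moments. Then: (i) ∫_{ℝᴺ} (Σ_{k=1}^N v_k²) N(I−Q)[f](v) dv = 0 (the Kac collisions conserve the total kinetic energy); and (ii) ∫_{ℝᴺ} (½ Σ_{k=1}^N v_k²) (λN(I−Q)[f](v) + μ Σ_{j=1}^N (I−R_j)[f](v)) dv = (μ/2)(K(f) − N/2), where K(f) = ½ ∫ (Σ_k v_k²) f(v) dv. Consequently, along solutions of the master equation ∂f/∂t = −λN(I−Q)f − μΣ_j(I−R_j)f, the kinetic energy obeys Newton's law of cooling dK/dt = −(μ/2)(K − N/2). -/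

import Mathlib

open MeasureTheory Real
open scoped BigOperators

noncomputable section

/-- standard Gaussian density on ℝ -/
def g (v : ℝ) : ℝ := (Real.sqrt (2 * Real.pi))⁻¹ * Real.exp (-v ^ 2 / 2)

/-- product Gaussian density on ℝᴺ -/
def gam (N : ℕ) (v : Fin N → ℝ) : ℝ := ∏ i, g (v i)

/-- the Gaussian measure γ(v)dv on ℝᴺ -/
def gmeas (N : ℕ) : Measure (Fin N → ℝ) :=
  volume.withDensity (fun v => ENNReal.ofReal (gam N v))

/-- average over θ ∈ [0, 2π] -/
def avg (F : ℝ → ℝ) : ℝ := (2 * Real.pi)⁻¹ * ∫ θ in (0:ℝ)..(2 * Real.pi), F θ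

/-- v with coordinates i,j rotated by angle θ -/
def rot (N : ℕ) (v : Fin N → ℝ) (i j : Fin N) (θ : ℝ) : Fin N → ℝ :=
  Function.update (Function.update v i (v i * Real.cos θ + v j * Real.sin θ)) j
    (-(v i) * Real.sin θ + v j * Real.cos θ)

/-- the Kac collision operator Q -/
def Qop (N : ℕ) (h : (Fin N → ℝ) → ℝ) (v : Fin N → ℝ) : ℝ :=
  ((N.choose 2 : ℝ))⁻¹ * ∑ i : Fin N, ∑ j : Fin N,
    if i < j then avg (fun θ => h (rot N v i j θ)) else 0

/-- 𝓛_K = N (I - Q) -/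
def LK (N : ℕ) (h : (Fin N → ℝ) → ℝ) (v : Fin N → ℝ) : ℝ :=
  (N : ℝ) * (h v - Qop N h v)

/-- v with j-th coordinate replaced by v_j cos θ + w sin θ -/
def rotw (N : ℕ) (v : Fin N → ℝ) (j : Fin N) (θ w : ℝ) : Fin N → ℝ :=
  Function.update v j (v j * Real.cos θ + w * Real.sin θ)

/-- the thermostat operator T_j -/
def Tj (N : ℕ) (j : Fin N) (h : (Fin N → ℝ) → ℝ) (v : Fin N → ℝ) : ℝ :=
  ∫ w : ℝ, g w * avg (fun θ => h (rotw N v j θ w))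

/-- 𝓛_T = Σ_j (I - T_j) -/
def LTherm (N : ℕ) (h : (Fin N → ℝ) → ℝ) (v : Fin N → ℝ) : ℝ :=
  ∑ j : Fin N, (h v - Tj N j h v)

/-- inner product on L²(ℝᴺ, γ dv) -/
def iprod (N : ℕ) (h₁ h₂ : (Fin N → ℝ) → ℝ) : ℝ :=
  ∫ v : Fin N → ℝ, h₁ v * h₂ v * gam N v

/-- probabilist's Hermite polynomial H_α(v) = (−1)ᵅ e^{v²/2} (d/dv)ᵅ e^{−v²/2} -/
def Herm (n : ℕ) (v : ℝ) : ℝ :=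
  (-1 : ℝ) ^ n * Real.exp (v ^ 2 / 2) * iteratedDeriv n (fun x => Real.exp (-x ^ 2 / 2)) v

/-- s_n = (2π)⁻¹ ∫₀^{2π} cosⁿ θ dθ -/
def sCoef (n : ℕ) : ℝ := avg (fun θ => Real.cos θ ^ n)

/-- the master-equation thermostat operator R_j acting on densities -/
def Rop (N : ℕ) (j : Fin N) (f : (Fin N → ℝ) → ℝ) (v : Fin N → ℝ) : ℝ :=
  ∫ w : ℝ, avg (fun θ =>
    g (-(v j) * Real.sin θ + w * Real.cos θ) * f (rotw N v j θ w))

/-- relative entropy S(f|γ) -/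
def relEnt (N : ℕ) (f : (Fin N → ℝ) → ℝ) : ℝ :=
  ∫ v : Fin N → ℝ, f v * Real.log (f v / gam N v)

lemma continuous_g : Continuous g := by
  unfold g; fun_prop

lemma g_eq_gaussianPDFReal (x : ℝ) : g x = ProbabilityTheory.gaussianPDFReal 0 1 x := by
  simp [g, ProbabilityTheory.gaussianPDFReal]

lemma integral_g : ∫ x, g x = 1 := by
  simp_rw [g_eq_gaussianPDFReal]
  exact ProbabilityTheory.integral_gaussianPDFReal_eq_one 0 one_ne_zero

lemma integral_sq_mul_g : ∫ x, x ^ 2 * g x = 1 := by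
  have h := ProbabilityTheory.variance_fun_id_gaussianReal (μ := 0) (v := 1)
  rw [ProbabilityTheory.variance_eq_integral (by fun_prop),
    ProbabilityTheory.integral_id_gaussianReal,
    ProbabilityTheory.integral_gaussianReal_eq_integral_smul one_ne_zero] at h
  simp_rw [g_eq_gaussianPDFReal]
  simpa [mul_comm] using h

lemma integrable_g : Integrable g :=
  .of_integral_ne_zero (by rw [integral_g]; exact one_ne_zero)

lemma integrable_sq_mul_g : Integrable fun x => x ^ 2 * g x :=
  .of_integral_ne_zero (by rw [integral_sq_mul_g]; exact one_ne_zero)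

lemma g_nonneg (x : ℝ) : 0 ≤ g x := by unfold g; positivity

lemma integrable_mul_g : Integrable fun x => x * g x := by
  refine (integrable_g.add integrable_sq_mul_g).mono'
    (continuous_id.mul continuous_g).aestronglyMeasurable (.of_forall fun x => ?_)
  rw [Pi.add_apply, Real.norm_eq_abs, abs_mul, abs_of_nonneg (g_nonneg x)]
  nlinarith [g_nonneg x, sq_nonneg (|x| - 1), sq_abs x,
    mul_nonneg (g_nonneg x) (sq_nonneg (|x| - 1)), mul_nonneg (g_nonneg x) (sq_nonneg x)]

lemma sum_sq_eq_add_add {N : ℕ} (v : Fin N → ℝ) {i j : Fin N} (hij : i ≠ j) :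
    ∑ k, v k ^ 2 = v i ^ 2 + v j ^ 2 + ∑ k ∈ (Finset.univ.erase i).erase j, v k ^ 2 := by
  rw [← Finset.add_sum_erase _ _ (Finset.mem_univ i),
    ← Finset.add_sum_erase (Finset.univ.erase i) (fun k => v k ^ 2) (a := j)
      (by simp [hij.symm]), add_assoc]

lemma rot_apply_left {N : ℕ} (v : Fin N → ℝ) {i j : Fin N} (hij : i ≠ j) (θ : ℝ) :
    rot N v i j θ i = v i * cos θ + v j * sin θ := by
  simp [rot, hij]

lemma rot_apply_right {N : ℕ} (v : Fin N → ℝ) (i j : Fin N) (θ : ℝ) :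
    rot N v i j θ j = -(v i) * sin θ + v j * cos θ := by
  simp [rot]

lemma rot_apply_of_ne {N : ℕ} (v : Fin N → ℝ) {i j k : Fin N} (hi : k ≠ i) (hj : k ≠ j) (θ : ℝ) :
    rot N v i j θ k = v k := by
  simp [rot, hi, hj]

lemma sum_sq_rot {N : ℕ} (v : Fin N → ℝ) {i j : Fin N} (hij : i ≠ j) (θ : ℝ) :
    ∑ k, rot N v i j θ k ^ 2 = ∑ k, v k ^ 2 := by
  rw [sum_sq_eq_add_add _ hij, sum_sq_eq_add_add v hij, rot_apply_left v hij, rot_apply_right]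
  congr 1
  · linear_combination (v i ^ 2 + v j ^ 2) * sin_sq_add_cos_sq θ
  · refine Finset.sum_congr rfl fun k hk => ?_
    simp only [Finset.mem_erase, Finset.mem_univ, and_true] at hk
    rw [rot_apply_of_ne v hk.2 hk.1]

lemma measurePreserving_rot {N : ℕ} {i j : Fin N} (hij : i ≠ j) (θ : ℝ) :
    MeasurePreserving fun v => rot N v i j θ := by
  have happ : ∀ (v : Fin N → ℝ) (k : Fin N), rot N v i j θ k =
      if k = j then -(v i) * sin θ + v j * cos θ
      else if k = i then v i * cos θ + v j * sin θ else v k := by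
    intro v k
    simp [rot, Function.update_apply]
  let T : EuclideanSpace ℝ (Fin N) →ₗ[ℝ] EuclideanSpace ℝ (Fin N) :=
    { toFun := fun v => WithLp.toLp 2 (rot N v.ofLp i j θ)
      map_add' := fun v w => by
        ext k
        simp only [happ, PiLp.add_apply]
        split_ifs <;> ring
      map_smul' := fun c v => by
        ext k
        simp only [happ, PiLp.smul_apply, smul_eq_mul, RingHom.id_apply]
        split_ifs <;> ring }
  let L : EuclideanSpace ℝ (Fin N) →ₗᵢ[ℝ] EuclideanSpace ℝ (Fin N) :=
    { T with
      norm_map' := fun v => by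
        rw [← sq_eq_sq₀ (norm_nonneg _) (norm_nonneg _), EuclideanSpace.real_norm_sq_eq,
          EuclideanSpace.real_norm_sq_eq]
        exact sum_sq_rot v.ofLp hij θ }
  exact ((PiLp.volume_preserving_ofLp (Fin N)).comp
    (L.toLinearIsometryEquiv rfl).measurePreserving).comp (PiLp.volume_preserving_toLp (Fin N))

lemma measurable_rot {N : ℕ} (i j : Fin N) :
    Measurable (Function.uncurry fun (θ : ℝ) (v : Fin N → ℝ) => rot N v i j θ) := by
  refine measurable_pi_iff.2 fun k => ?_
  simp only [Function.uncurry_def, rot, Function.update_apply]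
  split_ifs <;> fun_prop

/-- The restriction of Lebesgue measure to one period of the angle. -/
def angleMeasure : Measure ℝ := volume.restrict (Set.Ioc 0 (2 * π))

instance : IsFiniteMeasure angleMeasure := by
  unfold angleMeasure; infer_instance

lemma avg_eq (F : ℝ → ℝ) : avg F = (2 * π)⁻¹ * ∫ θ, F θ ∂angleMeasure := by
  rw [avg, intervalIntegral.integral_of_le (by positivity), angleMeasure]

lemma avg_const_mul (c : ℝ) (F : ℝ → ℝ) : avg (fun θ => c * F θ) = c * avg F := by
  simp only [avg_eq, integral_const_mul]; ring

lemma avg_const (c : ℝ) : avg (fun _ => c) = c := by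
  have := pi_pos
  rw [avg, intervalIntegral.integral_const, smul_eq_mul]; field_simp; ring

lemma avg_sin_sq : avg (fun θ => sin θ ^ 2) = 1 / 2 := by
  have := pi_pos
  rw [avg, integral_sin_sq]
  simp
  field_simp

lemma avg_sin_mul_cos : avg (fun θ => sin θ * cos θ) = 0 := by
  rw [avg, integral_sin_mul_cos₁]
  simp

lemma integrable_angleMeasure {F : ℝ → ℝ} (hF : Continuous F) : Integrable F angleMeasure :=
  (hF.integrableOn_Icc (a := 0) (b := 2 * π)).mono_set Set.Ioc_subset_Icc_self

section Averaging

variable {X : Type*} [MeasurableSpace X] {ν : Measure X} [SFinite ν] {T : ℝ → X → X}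

lemma integrable_comp_angle (hT : Measurable (Function.uncurry T))
    (hpres : ∀ θ, MeasurePreserving (T θ) ν ν) {Φ : ℝ × X → ℝ}
    (hΦ : Integrable Φ (angleMeasure.prod ν)) :
    Integrable (fun p : X × ℝ => Φ (p.2, T p.2 p.1)) (ν.prod angleMeasure) ∧
      ∫ p : X × ℝ, Φ (p.2, T p.2 p.1) ∂(ν.prod angleMeasure) =
        ∫ q, Φ q ∂(angleMeasure.prod ν) := by
  have hmp : MeasurePreserving (fun p : X × ℝ => (p.2, T p.2 p.1)) (ν.prod angleMeasure)
      (angleMeasure.prod ν) :=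
    ((MeasurePreserving.id angleMeasure).skew_product hT
      (.of_forall fun θ => (hpres θ).map_eq)).comp Measure.measurePreserving_swap
  refine ⟨hmp.integrable_comp_of_integrable hΦ, ?_⟩
  have h := integral_map hmp.aemeasurable (f := Φ)
    (by rw [hmp.map_eq]; exact hΦ.aestronglyMeasurable)
  rw [← h, hmp.map_eq]

lemma integrable_avg_comp (hT : Measurable (Function.uncurry T))
    (hpres : ∀ θ, MeasurePreserving (T θ) ν ν) {Φ : ℝ × X → ℝ}
    (hΦ : Integrable Φ (angleMeasure.prod ν)) :
    Integrable (fun x => avg fun θ => Φ (θ, T θ x)) ν := by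
  simp only [avg_eq]
  exact (integrable_comp_angle hT hpres hΦ).1.integral_prod_left.const_mul _

lemma integral_avg_comp (hT : Measurable (Function.uncurry T))
    (hpres : ∀ θ, MeasurePreserving (T θ) ν ν) {Φ : ℝ × X → ℝ}
    (hΦ : Integrable Φ (angleMeasure.prod ν)) :
    ∫ x, avg (fun θ => Φ (θ, T θ x)) ∂ν = (2 * π)⁻¹ * ∫ q, Φ q ∂(angleMeasure.prod ν) := by
  obtain ⟨h₁, h₂⟩ := integrable_comp_angle hT hpres hΦ
  simp only [avg_eq]
  rw [integral_const_mul, ← h₂, integral_prod _ h₁]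

end Averaging

lemma integrable_mul_comp_snd {X : Type*} [MeasurableSpace X] {ν : Measure X} [SFinite ν]
    {a : ℝ → ℝ} (ha : Continuous a) {F : X → ℝ} (hF : Integrable F ν) :
    Integrable (fun q : ℝ × X => a q.1 * F q.2) (angleMeasure.prod ν) :=
  (integrable_angleMeasure ha).mul_prod hF

lemma integral_mul_comp_snd {X : Type*} [MeasurableSpace X] {ν : Measure X} [SFinite ν]
    (a : ℝ → ℝ) (F : X → ℝ) :
    (2 * π)⁻¹ * ∫ q : ℝ × X, a q.1 * F q.2 ∂(angleMeasure.prod ν) = avg a * ∫ x, F x ∂ν := by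
  rw [integral_prod_mul, avg_eq, mul_assoc]

section KacCollision

variable {N : ℕ} {f : (Fin N → ℝ) → ℝ}

lemma energy_mul_avg_rot {i j : Fin N} (hij : i ≠ j)
    (hmom : Integrable fun v : Fin N → ℝ => (∑ k, v k ^ 2) * f v) :
    Integrable (fun v : Fin N → ℝ => (∑ k, v k ^ 2) * avg fun θ => f (rot N v i j θ)) ∧
      ∫ v : Fin N → ℝ, (∑ k, v k ^ 2) * avg (fun θ => f (rot N v i j θ)) =
        ∫ v : Fin N → ℝ, (∑ k, v k ^ 2) * f v := by
  have hΦ := integrable_mul_comp_snd (a := fun _ => 1) continuous_const hmom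
  have heq : ∀ v : Fin N → ℝ, (∑ k, v k ^ 2) * avg (fun θ => f (rot N v i j θ)) =
      avg fun θ => 1 * ((∑ k, rot N v i j θ k ^ 2) * f (rot N v i j θ)) := by
    intro v
    simp only [sum_sq_rot v hij, one_mul, avg_const_mul]
  simp only [heq]
  refine ⟨integrable_avg_comp (measurable_rot i j) (measurePreserving_rot hij) hΦ, ?_⟩
  have h := integral_avg_comp (measurable_rot i j) (measurePreserving_rot hij) hΦ
  refine h.trans ((integral_mul_comp_snd (fun _ => 1)
    fun v : Fin N → ℝ => (∑ k, v k ^ 2) * f v).trans ?_)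
  rw [avg_const, one_mul]

lemma sum_sum_ite_lt (N : ℕ) (c : ℝ) :
    ∑ i : Fin N, ∑ j : Fin N, (if i < j then c else 0) = (N.choose 2 : ℝ) * c := by
  rw [Finset.sum_comm]
  have h : ∀ j : Fin N, ∑ i : Fin N, (if i < j then c else 0) = (j : ℕ) * c := by
    intro j
    rw [← Finset.sum_filter, Finset.sum_const, nsmul_eq_mul, Finset.filter_gt_eq_Iio,
      Fin.card_Iio]
  simp only [h]
  rw [Fin.sum_univ_eq_sum_range (fun n => (n : ℝ) * c), ← Finset.sum_mul, ← Nat.cast_sum,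
    Finset.sum_range_id, Nat.choose_two_right]

lemma energy_mul_LK (hN : 2 ≤ N)
    (hmom : Integrable fun v : Fin N → ℝ => (∑ k, v k ^ 2) * f v) :
    Integrable (fun v : Fin N → ℝ => (∑ k, v k ^ 2) * LK N f v) ∧
      ∫ v : Fin N → ℝ, (∑ k, v k ^ 2) * LK N f v = 0 := by
  have heq : ∀ v : Fin N → ℝ, (∑ k, v k ^ 2) * LK N f v =
      N * ((∑ k, v k ^ 2) * f v - ((N.choose 2 : ℝ))⁻¹ * ∑ i : Fin N, ∑ j : Fin N,
        if i < j then (∑ k, v k ^ 2) * avg (fun θ => f (rot N v i j θ)) else 0) := by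
    intro v
    have hite : ∀ i j : Fin N,
        (if i < j then (∑ k, v k ^ 2) * avg (fun θ => f (rot N v i j θ)) else 0) =
          (∑ k, v k ^ 2) * if i < j then avg (fun θ => f (rot N v i j θ)) else 0 := by
      intro i j
      split_ifs <;> simp
    simp only [hite, ← Finset.mul_sum]
    rw [LK, Qop]
    ring
  have hterm : ∀ i j : Fin N, Integrable fun v : Fin N → ℝ =>
      if i < j then (∑ k, v k ^ 2) * avg (fun θ => f (rot N v i j θ)) else 0 := by
    intro i j
    split_ifs with hij
    · exact (energy_mul_avg_rot hij.ne hmom).1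
    · exact integrable_zero _ _ _
  have hval : ∀ i j : Fin N, ∫ v : Fin N → ℝ,
      (if i < j then (∑ k, v k ^ 2) * avg (fun θ => f (rot N v i j θ)) else 0) =
        if i < j then ∫ v : Fin N → ℝ, (∑ k, v k ^ 2) * f v else 0 := by
    intro i j
    split_ifs with hij
    · exact (energy_mul_avg_rot hij.ne hmom).2
    · exact integral_zero _ _
  have hrow : ∀ i : Fin N, Integrable fun v : Fin N → ℝ => ∑ j : Fin N,
      if i < j then (∑ k, v k ^ 2) * avg (fun θ => f (rot N v i j θ)) else 0 :=
    fun i => integrable_finsetSum _ fun j _ => hterm i j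
  have hsum := integrable_finsetSum Finset.univ fun i _ => hrow i
  simp only [heq]
  refine ⟨(hmom.sub (hsum.const_mul _)).const_mul _, ?_⟩
  rw [integral_const_mul, integral_sub hmom (hsum.const_mul _), integral_const_mul,
    integral_finsetSum _ fun i _ => hrow i]
  simp only [integral_finsetSum Finset.univ fun j _ => hterm _ j, hval]
  have hne : (N.choose 2 : ℝ) ≠ 0 := by exact_mod_cast (Nat.choose_pos hN).ne'
  rw [sum_sum_ite_lt, inv_mul_cancel_left₀ hne, sub_self, mul_zero]

end KacCollision

section Thermostat

variable {N : ℕ} {f : (Fin N → ℝ) → ℝ}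

/-- The joint rotation of a bath velocity `p.1` and the `j`-th coordinate of `p.2`. -/
def bathRot (j : Fin N) (θ : ℝ) (p : ℝ × (Fin N → ℝ)) : ℝ × (Fin N → ℝ) :=
  (-(p.2 j) * sin θ + p.1 * cos θ, rotw N p.2 j θ p.1)

lemma measurePreserving_bathRot (j : Fin N) (θ : ℝ) : MeasurePreserving (bathRot j θ) := by
  have he := volume_preserving_piFinSuccAbove (fun _ : Fin (N + 1) => ℝ) 0
  have h := (he.comp (measurePreserving_rot (Fin.succ_ne_zero j) θ)).comp he.symm
  convert! h using 1
  funext p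
  refine Prod.ext ?_ (funext fun k => ?_)
  · simp [bathRot, rot, MeasurableEquiv.piFinSuccAbove, Fin.insertNthEquiv]
  · by_cases hk : k = j <;>
      simp [bathRot, rot, rotw, MeasurableEquiv.piFinSuccAbove, Fin.insertNthEquiv,
        hk]

lemma measurable_bathRot (j : Fin N) : Measurable (Function.uncurry (bathRot j)) := by
  refine Measurable.prodMk (by fun_prop) (measurable_pi_iff.2 fun k => ?_)
  simp only [rotw, Function.update_apply]
  split_ifs <;> fun_prop

/-- The energy-weighted joint density of the system and the bath, in post-collisional variables. -/
def bathEnergy (f : (Fin N → ℝ) → ℝ) (j : Fin N) (q : ℝ × (ℝ × (Fin N → ℝ))) : ℝ :=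
  1 * (g q.2.1 * ((∑ k, q.2.2 k ^ 2) * f q.2.2))
    + -1 * sin q.1 ^ 2 * (g q.2.1 * (q.2.2 j ^ 2 * f q.2.2))
    + -2 * (sin q.1 * cos q.1) * (q.2.1 * g q.2.1 * (q.2.2 j * f q.2.2))
    + sin q.1 ^ 2 * (q.2.1 ^ 2 * g q.2.1 * f q.2.2)

lemma bathEnergy_bathRot (j : Fin N) (θ w : ℝ) (v : Fin N → ℝ) :
    bathEnergy f j (θ, bathRot j θ (w, v)) =
      (∑ k, v k ^ 2) * (g (-(v j) * sin θ + w * cos θ) * f (rotw N v j θ w)) := by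
  have hsplit : ∀ u : Fin N → ℝ, ∑ k, u k ^ 2 = u j ^ 2 + ∑ k ∈ Finset.univ.erase j, u k ^ 2 :=
    fun u => (Finset.add_sum_erase _ _ (Finset.mem_univ j)).symm
  have hj : rotw N v j θ w j = v j * cos θ + w * sin θ := by simp [rotw]
  have hrest : ∑ k ∈ Finset.univ.erase j, rotw N v j θ w k ^ 2 =
      ∑ k ∈ Finset.univ.erase j, v k ^ 2 :=
    Finset.sum_congr rfl fun k hk => by simp [rotw, Finset.ne_of_mem_erase hk]
  simp only [bathEnergy, bathRot, hsplit, hrest, hj]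
  have hc : cos θ ^ 2 = 1 - sin θ ^ 2 := by rw [← sin_sq_add_cos_sq θ]; ring
  set G := g (-(v j) * sin θ + w * cos θ)
  set F := f (rotw N v j θ w)
  have key : (v j * cos θ + w * sin θ) ^ 2 - sin θ ^ 2 * (v j * cos θ + w * sin θ) ^ 2
      - 2 * (sin θ * cos θ) * ((-(v j) * sin θ + w * cos θ) * (v j * cos θ + w * sin θ))
      + sin θ ^ 2 * (-(v j) * sin θ + w * cos θ) ^ 2 = v j ^ 2 := by
    have : (v j * cos θ + w * sin θ) ^ 2 - sin θ ^ 2 * (v j * cos θ + w * sin θ) ^ 2 =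
        cos θ ^ 2 * (v j * cos θ + w * sin θ) ^ 2 := by rw [hc]; ring
    rw [this]
    linear_combination (v j ^ 2 * (sin θ ^ 2 + cos θ ^ 2 + 1)) * sin_sq_add_cos_sq θ
  linear_combination G * F * key

lemma integrable_coord_sq_mul (hmeas : Measurable f)
    (hmom : Integrable fun v : Fin N → ℝ => (∑ k, v k ^ 2) * f v) (j : Fin N) :
    Integrable fun v : Fin N → ℝ => v j ^ 2 * f v := by
  refine hmom.mono (by fun_prop) (.of_forall fun v => ?_)
  rw [norm_mul, norm_mul, Real.norm_of_nonneg (sq_nonneg _),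
    Real.norm_of_nonneg (Finset.sum_nonneg fun k _ => sq_nonneg (v k))]
  gcongr
  exact Finset.single_le_sum (f := fun k => v k ^ 2) (fun k _ => sq_nonneg _) (Finset.mem_univ j)

lemma integrable_coord_mul (hmeas : Measurable f) (hf : Integrable f)
    (hmom : Integrable fun v : Fin N → ℝ => (∑ k, v k ^ 2) * f v) (j : Fin N) :
    Integrable fun v : Fin N → ℝ => v j * f v := by
  refine (hf.norm.add (integrable_coord_sq_mul hmeas hmom j).norm).mono'
    (by fun_prop) (.of_forall fun v => ?_)
  simp only [Pi.add_apply, norm_mul, norm_pow]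
  nlinarith [norm_nonneg (f v), mul_nonneg (norm_nonneg (f v)) (sq_nonneg (‖v j‖ - 1)),
    mul_nonneg (norm_nonneg (f v)) (sq_nonneg ‖v j‖)]

lemma bathEnergy_integral (hmeas : Measurable f) (hf : Integrable f)
    (hmom : Integrable fun v : Fin N → ℝ => (∑ k, v k ^ 2) * f v) (j : Fin N) :
    Integrable (bathEnergy f j) (angleMeasure.prod volume) ∧
      (2 * π)⁻¹ * ∫ q, bathEnergy f j q ∂(angleMeasure.prod volume) =
        (∫ v : Fin N → ℝ, (∑ k, v k ^ 2) * f v) - 1 / 2 * (∫ v : Fin N → ℝ, v j ^ 2 * f v)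
          + 1 / 2 * ∫ v, f v := by
  have h₁ := integrable_mul_comp_snd (a := fun _ => 1) continuous_const
    (integrable_g.mul_prod hmom)
  have h₂ := integrable_mul_comp_snd (a := fun θ => -1 * sin θ ^ 2) (by fun_prop)
    (integrable_g.mul_prod (integrable_coord_sq_mul hmeas hmom j))
  have h₃ := integrable_mul_comp_snd (a := fun θ => -2 * (sin θ * cos θ)) (by fun_prop)
    (integrable_mul_g.mul_prod (integrable_coord_mul hmeas hf hmom j))
  have h₄ := integrable_mul_comp_snd (a := fun θ => sin θ ^ 2) (by fun_prop)
    (integrable_sq_mul_g.mul_prod hf)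
  refine ⟨((h₁.add h₂).add h₃).add h₄, ?_⟩
  have hsum : ∫ q, bathEnergy f j q ∂(angleMeasure.prod volume) = _ :=
    (integral_add ((h₁.add h₂).add h₃) h₄).trans <| congrArg (· + _) <|
      (integral_add (h₁.add h₂) h₃).trans <| congrArg (· + _) <| integral_add h₁ h₂
  have e₁ := integral_mul_comp_snd (ν := volume) (fun _ => 1)
    fun p : ℝ × (Fin N → ℝ) => g p.1 * ((∑ k, p.2 k ^ 2) * f p.2)
  have e₂ := integral_mul_comp_snd (ν := volume) (fun θ => -1 * sin θ ^ 2)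
    fun p : ℝ × (Fin N → ℝ) => g p.1 * (p.2 j ^ 2 * f p.2)
  have e₃ := integral_mul_comp_snd (ν := volume) (fun θ => -2 * (sin θ * cos θ))
    fun p : ℝ × (Fin N → ℝ) => p.1 * g p.1 * (p.2 j * f p.2)
  have e₄ := integral_mul_comp_snd (ν := volume) (fun θ => sin θ ^ 2)
    fun p : ℝ × (Fin N → ℝ) => p.1 ^ 2 * g p.1 * f p.2
  have p₁ := integral_prod_mul (μ := volume) (ν := volume) g
    fun v : Fin N → ℝ => (∑ k, v k ^ 2) * f v
  have p₂ := integral_prod_mul (μ := volume) (ν := volume) g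
    fun v : Fin N → ℝ => v j ^ 2 * f v
  have p₄ := integral_prod_mul (μ := volume) (ν := volume) (fun w => w ^ 2 * g w) f
  rw [← Measure.volume_eq_prod, integral_g, one_mul] at p₁ p₂
  rw [← Measure.volume_eq_prod, integral_sq_mul_g, one_mul] at p₄
  rw [avg_const, one_mul, p₁] at e₁
  rw [avg_const_mul, avg_sin_sq, p₂] at e₂
  rw [avg_const_mul, avg_sin_mul_cos, mul_zero, zero_mul] at e₃
  rw [avg_sin_sq, p₄] at e₄
  rw [hsum, mul_add, mul_add, mul_add]
  linear_combination e₁ + e₂ + e₃ + e₄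

lemma energy_mul_Rop (hmeas : Measurable f) (hf : Integrable f)
    (hmom : Integrable fun v : Fin N → ℝ => (∑ k, v k ^ 2) * f v) (j : Fin N) :
    Integrable (fun v : Fin N → ℝ => (∑ k, v k ^ 2) * Rop N j f v) ∧
      ∫ v : Fin N → ℝ, (∑ k, v k ^ 2) * Rop N j f v =
        (∫ v : Fin N → ℝ, (∑ k, v k ^ 2) * f v) - 1 / 2 * (∫ v : Fin N → ℝ, v j ^ 2 * f v)
          + 1 / 2 * ∫ v, f v := by
  obtain ⟨hΦ, hval⟩ := bathEnergy_integral hmeas hf hmom j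
  have hint := integrable_avg_comp (measurable_bathRot j) (measurePreserving_bathRot j) hΦ
  have hI := integral_avg_comp (measurable_bathRot j) (measurePreserving_bathRot j) hΦ
  have heq : ∀ v : Fin N → ℝ, (∑ k, v k ^ 2) * Rop N j f v =
      ∫ w, avg fun θ => bathEnergy f j (θ, bathRot j θ (w, v)) := by
    intro v
    simp only [bathEnergy_bathRot, avg_const_mul, integral_const_mul, Rop]
  simp only [heq]
  refine ⟨hint.integral_prod_right, ?_⟩
  rw [← hval, ← hI]
  exact (integral_prod_symm _ hint).symm

end Thermostat

/-- the Kac collisions conserve kinetic energy, and the thermostated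
Kac generator yields Newton's law of cooling for the kinetic energy
K(f) = ½∫(Σ_k v_k²) f dv. -/
theorem newtons_law_of_cooling (N : ℕ) (hN : 2 ≤ N) (lam mu : ℝ)
    (hlam : 0 < lam) (hmu : 0 < mu) (f : (Fin N → ℝ) → ℝ)
    (hmeas : Measurable f) (hpos : ∀ v, 0 ≤ f v)
    (hprob : ∫ v : Fin N → ℝ, f v = 1)
    (hmom : Integrable (fun v : Fin N → ℝ => (∑ k, v k ^ 2) * f v)) :
    (∫ v : Fin N → ℝ, (∑ k, v k ^ 2) * LK N f v = 0)
    ∧ (∫ v : Fin N → ℝ,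
          ((1 / 2) * ∑ k, v k ^ 2) * (lam * LK N f v + mu * ∑ j, (f v - Rop N j f v))
        = (mu / 2) * ((1 / 2) * (∫ v : Fin N → ℝ, (∑ k, v k ^ 2) * f v) - (N : ℝ) / 2)) := by
  have hf : Integrable f := .of_integral_ne_zero (by rw [hprob]; exact one_ne_zero)
  obtain ⟨hK, hK0⟩ := energy_mul_LK hN hmom
  refine ⟨hK0, ?_⟩
  have hR := fun j => energy_mul_Rop hmeas hf hmom j
  have hdiff : ∀ j : Fin N, Integrable fun v : Fin N → ℝ =>
      (∑ k, v k ^ 2) * f v - (∑ k, v k ^ 2) * Rop N j f v := fun j => hmom.sub (hR j).1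
  have hS : Integrable fun v : Fin N → ℝ => ∑ j : Fin N,
      ((∑ k, v k ^ 2) * f v - (∑ k, v k ^ 2) * Rop N j f v) :=
    integrable_finsetSum _ fun j _ => hdiff j
  have heq : ∀ v : Fin N → ℝ,
      ((1 / 2) * ∑ k, v k ^ 2) * (lam * LK N f v + mu * ∑ j, (f v - Rop N j f v)) =
        lam / 2 * ((∑ k, v k ^ 2) * LK N f v) + mu / 2 * ∑ j : Fin N,
          ((∑ k, v k ^ 2) * f v - (∑ k, v k ^ 2) * Rop N j f v) := by
    intro v
    simp only [← mul_sub, ← Finset.mul_sum]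
    ring
  simp only [heq]
  rw [integral_add (hK.const_mul _) (hS.const_mul _), integral_const_mul, integral_const_mul, hK0,
    integral_finsetSum _ fun j _ => hdiff j]
  simp only [integral_sub hmom (hR _).1, (hR _).2, hprob]
  have henergy : ∑ j : Fin N, ∫ v : Fin N → ℝ, v j ^ 2 * f v =
      ∫ v : Fin N → ℝ, (∑ k, v k ^ 2) * f v := by
    rw [← integral_finsetSum _ fun j _ => integrable_coord_sq_mul hmeas hmom j]
    simp only [Finset.sum_mul]
  rw [← henergy]
  have hcancel : ∀ a b : ℝ, a - (a - 1 / 2 * b + 1 / 2 * 1) = 1 / 2 * b - 1 / 2 := by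
    intro a b; ring
  simp only [hcancel, Finset.sum_sub_distrib, ← Finset.mul_sum, Finset.sum_const,
    Finset.card_univ, Fintype.card_fin, nsmul_eq_mul]
  ring

end
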